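/- For every orientation-reversing gluing pattern φ of the faces of the octahedron, the complement in the quotient space X(φ) of the images of the six vertices of the octahedron is a topological 3-manifold without boundary: every point of X(φ) that is not the image of a vertex has an open neighbourhood homeomorphic to ℝ³. -/

import Mathlib

/-! Combinatorial model of the octahedron and of orientation-reversing gluing
patterns of its faces, following Heard–Pervova–Petronio. -/

/-- Vertices of the octahedron `±e_i`, encoded as a pair (axis, sign). -/
abbrev OctVertex : Type := Fin 3 × Bool

/-- Faces of the octahedron: a choice of a sign for each coordinate axis;
the face `F` has vertex set `{(i, F i) : i ∈ Fin 3}`. -/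
abbrev OctFace : Type := Fin 3 → Bool

/-- The parity of a face.  The cyclic order (axis 0, axis 1, axis 2) of the vertices of
a face `F` agrees with the cyclic order induced by the outward orientation of the
boundary of the solid octahedron if and only if `faceSign F = true`. -/
def faceSign (F : OctFace) : Bool := Bool.xor (F 0) (Bool.xor (F 1) (F 2))

/-- `IsGluing σ π` says that the fixed-point-free involution `σ` of the set of faces,
together with the face identifications `π` (the bijection `φ_F` from the vertices of `F`
to those of `σ F` sends the vertex of `F` on axis `i` to the vertex of `σ F` on axis
`π F i`), is an orientation-reversing gluing pattern: `φ_{σ F} = φ_F⁻¹` and every `φ_F`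
reverses the cyclic orderings induced by the boundary orientation (a bijection
`F → σ F` given by `π` reverses them iff `sign (π) · faceSign F · faceSign (σ F) = -1`). -/
def IsGluing (σ : Equiv.Perm OctFace) (π : OctFace → Equiv.Perm (Fin 3)) : Prop :=
  (∀ F, σ (σ F) = F) ∧ (∀ F, σ F ≠ F) ∧ (∀ F, π (σ F) = (π F)⁻¹) ∧
    (∀ F, Equiv.Perm.sign (π F) = 1 ↔ faceSign F ≠ faceSign (σ F))

instance : DecidablePred fun p : Equiv.Perm OctFace × (OctFace → Equiv.Perm (Fin 3)) =>
    IsGluing p.1 p.2 := fun p => by unfold IsGluing; infer_instance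

/-- An orientation-reversing gluing pattern of the faces of the octahedron. -/
abbrev Gluing : Type :=
  {p : Equiv.Perm OctFace × (OctFace → Equiv.Perm (Fin 3)) // IsGluing p.1 p.2}

/-- The involution on faces underlying a gluing pattern. -/
def Gluing.face (g : Gluing) : Equiv.Perm OctFace := g.1.1

/-- The face identifications of a gluing pattern, as permutations of the axes. -/
def Gluing.axisMap (g : Gluing) : OctFace → Equiv.Perm (Fin 3) := g.1.2

/-- The action of the symmetry of the octahedron given by the signed axis permutation
`(ρ, ε)` (sending the vertex `(i, b)` to `(ρ i, xor b (ε i))`) on faces. -/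
def symMapFace (ρ : Equiv.Perm (Fin 3)) (ε : Fin 3 → Bool) (F : OctFace) : OctFace :=
  fun j => Bool.xor (F (ρ⁻¹ j)) (ε (ρ⁻¹ j))

/-- Two gluing patterns are combinatorially equivalent if some symmetry of the
octahedron conjugates one into the other. -/
def EquivGluing (g h : Gluing) : Prop :=
  ∃ (ρ : Equiv.Perm (Fin 3)) (ε : Fin 3 → Bool),
    (∀ F, h.face (symMapFace ρ ε F) = symMapFace ρ ε (g.face F)) ∧
    (∀ F, h.axisMap (symMapFace ρ ε F) = ρ * g.axisMap F * ρ⁻¹)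

/-- The combinatorial equivalence class (orbit under the symmetry group) of a gluing. -/
def orbit (g : Gluing) : Set Gluing := {h | EquivGluing g h}

/-- The identifications induced by a gluing pattern on the vertices of the octahedron:
the vertex of `F` on axis `i` is glued to the corresponding vertex of `face F`. -/
def vtxRel (g : Gluing) (v w : OctVertex) : Prop :=
  ∃ (F : OctFace) (i : Fin 3),
    v = (i, F i) ∧ w = (g.axisMap F i, g.face F (g.axisMap F i))

/-- The equivalence relation on vertices generated by the face identifications. -/
def vtxSetoid (g : Gluing) : Setoid OctVertex := Relation.EqvGen.setoid (vtxRel g)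

/-- The number of vertex classes of a gluing pattern. -/
noncomputable def vtxCount (g : Gluing) : ℕ := Nat.card (Quotient (vtxSetoid g))

/-- An edge-end (corner) of the octahedron: an ordered pair of vertices lying on
distinct axes; it represents the edge between them together with the choice of the
first vertex as its endpoint.  Edge-ends correspond to the corners of the
quadrilateral vertex links. -/
abbrev EdgeEnd : Type := {p : OctVertex × OctVertex // p.1.1 ≠ p.2.1}

/-- The identifications induced by a gluing pattern on edge-ends: an edge-end contained
in the face `F` is glued to the corresponding edge-end of `face F`. -/
def endRel (g : Gluing) (p q : EdgeEnd) : Prop :=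
  ∃ (F : OctFace) (i j : Fin 3), i ≠ j ∧ p.1 = ((i, F i), (j, F j)) ∧
    q.1 = ((g.axisMap F i, g.face F (g.axisMap F i)),
           (g.axisMap F j, g.face F (g.axisMap F j)))

/-- The equivalence relation on edge-ends generated by the face identifications.
Its classes are the vertices of the quadrangulated link surfaces of the vertex
classes. -/
def endSetoid (g : Gluing) : Setoid EdgeEnd := Relation.EqvGen.setoid (endRel g)

/-- The relation on edge-ends generating the edge identifications: face identifications
together with forgetting the choice of endpoint. -/
def edgeRel (g : Gluing) (p q : EdgeEnd) : Prop :=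
  endRel g p q ∨ q.1 = (p.1.2, p.1.1)

/-- The equivalence relation whose classes are the edge classes of a gluing pattern. -/
def edgeSetoid (g : Gluing) : Setoid EdgeEnd := Relation.EqvGen.setoid (edgeRel g)

/-- The number of edge classes of a gluing pattern. -/
noncomputable def edgeCount (g : Gluing) : ℕ := Nat.card (Quotient (edgeSetoid g))

/-- The number of vertices of the octahedron lying in the vertex class `c`; this is
the number of quadrilaterals tiling the link surface of `c`. -/
noncomputable def classSize (g : Gluing) (c : Quotient (vtxSetoid g)) : ℕ :=
  Nat.card {v : OctVertex // Quotient.mk (vtxSetoid g) v = c}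

/-- The number of vertices of the quadrangulated link surface of the vertex class `c`:
the number of classes of edge-ends whose endpoint lies in `c`. -/
noncomputable def cornerCount (g : Gluing) (c : Quotient (vtxSetoid g)) : ℕ :=
  Nat.card {q : Quotient (endSetoid g) //
    ∃ p : EdgeEnd, Quotient.mk (endSetoid g) p = q ∧ Quotient.mk (vtxSetoid g) p.1.1 = c}

/-- The Euler characteristic of the link surface of the vertex class `c`: the link is
tiled by `classSize g c` quadrilaterals, with `2 * classSize g c` edges and
`cornerCount g c` vertices, so `χ = cornerCount - 2 * classSize + classSize`. -/
noncomputable def linkChi (g : Gluing) (c : Quotient (vtxSetoid g)) : ℤ :=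
  (cornerCount g c : ℤ) - (classSize g c : ℤ)

/-- All vertex links are 2-spheres: the quotient space is a closed manifold. -/
def AllLinksSphere (g : Gluing) : Prop := ∀ c, linkChi g c = 2

/-- The non-sphere vertex-link data consists of a single torus. -/
def LinksOneTorus (g : Gluing) : Prop :=
  (∀ c, linkChi g c = 2 ∨ linkChi g c = 0) ∧
    Nat.card {c : Quotient (vtxSetoid g) // linkChi g c = 0} = 1

/-- The non-sphere vertex-link data consists of two tori. -/
def LinksTwoTori (g : Gluing) : Prop :=
  (∀ c, linkChi g c = 2 ∨ linkChi g c = 0) ∧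
    Nat.card {c : Quotient (vtxSetoid g) // linkChi g c = 0} = 2

/-- The non-sphere vertex-link data consists of a single genus-2 surface. -/
def LinksGenusTwo (g : Gluing) : Prop :=
  (∀ c, linkChi g c = 2 ∨ linkChi g c = -2) ∧
    Nat.card {c : Quotient (vtxSetoid g) // linkChi g c = -2} = 1

/-- The non-sphere vertex-link data consists of one genus-2 surface and one torus. -/
def LinksGenusTwoTorus (g : Gluing) : Prop :=
  (∀ c, linkChi g c = 2 ∨ linkChi g c = 0 ∨ linkChi g c = -2) ∧
    Nat.card {c : Quotient (vtxSetoid g) // linkChi g c = 0} = 1 ∧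
    Nat.card {c : Quotient (vtxSetoid g) // linkChi g c = -2} = 1

/-- The non-sphere vertex-link data consists of a single genus-3 surface. -/
def LinksGenusThree (g : Gluing) : Prop :=
  (∀ c, linkChi g c = 2 ∨ linkChi g c = -4) ∧
    Nat.card {c : Quotient (vtxSetoid g) // linkChi g c = -4} = 1

/-! The geometric realization: the solid octahedron in `ℝ³` and the quotient
space `X(φ)` of a gluing pattern `φ`. -/

/-- The point `±e_i` of `ℝ³` corresponding to a vertex of the octahedron. -/
def vertexPt (v : OctVertex) : Fin 3 → ℝ :=
  fun j => if j = v.1 then (if v.2 then 1 else -1) else 0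

/-- The solid octahedron: the convex hull of `{±e₁, ±e₂, ±e₃}` in `ℝ³`. -/
def SolidOcta : Set (Fin 3 → ℝ) := convexHull ℝ (Set.range vertexPt)

theorem vertexPt_mem_solidOcta (v : OctVertex) : vertexPt v ∈ SolidOcta :=
  subset_convexHull ℝ _ (Set.mem_range_self v)

/-- The gluing relation on the solid octahedron: the point of the closed triangular face
of `F` with barycentric coordinates `w` is glued to the point of the face of
`face F` with the corresponding barycentric coordinates, i.e. the faces
are identified via the affine extensions of the combinatorial identifications. -/
def glueRel (g : Gluing) (x y : SolidOcta) : Prop :=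
  ∃ (F : OctFace) (w : Fin 3 → ℝ), (∀ i, 0 ≤ w i) ∧ (∑ i, w i) = 1 ∧
    (x : Fin 3 → ℝ) = ∑ i, w i • vertexPt (i, F i) ∧
    (y : Fin 3 → ℝ) = ∑ i, w i • vertexPt (g.axisMap F i, g.face F (g.axisMap F i))

/-- The equivalence relation on the solid octahedron generated by the affine face
identifications of a gluing pattern. -/
def glueSetoid (g : Gluing) : Setoid SolidOcta := Relation.EqvGen.setoid (glueRel g)

/-- The quotient space `X(φ)` of the solid octahedron by the gluing pattern `φ`,
with the quotient topology. -/
abbrev XSpace (g : Gluing) : Type := Quotient (glueSetoid g)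

open Topology
/-- Local chart lemma: a compact "development" `D` of a neighbourhood. -/
theorem chart_lemma {O D E : Type*} [TopologicalSpace O] [T2Space O] (r : O → O → Prop)
    [TopologicalSpace D] [CompactSpace D] [NormedAddCommGroup E] [NormedSpace ℝ E]
    [FiniteDimensional ℝ E] (hE : Module.finrank ℝ E = 3)
    (c : D → O) (f : D → E) (hc : Continuous c) (hf : Continuous f) (e0 : E) (δ : ℝ) (hδ : 0 < δ)
    (hsurj : ∀ e ∈ Metric.ball e0 δ, ∃ d, f d = e)
    (h1 : ∀ d d', f d = f d' → Relation.EqvGen r (c d) (c d'))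
    (h2 : ∀ d x, r (c d) x → ∃ d', c d' = x ∧ f d' = f d)
    (hsymm : ∀ x y, r x y → r y x)
    (h3 : ∀ d d', c d = c d' → f d = f d')
    (hopen : IsOpen (c '' (f ⁻¹' Metric.ball e0 δ)))
    (d0 : D) (hd0 : f d0 ∈ Metric.ball e0 δ) :
    ∃ U : Set (Quotient (Relation.EqvGen.setoid r)), IsOpen U ∧
      Quotient.mk (Relation.EqvGen.setoid r) (c d0) ∈ U ∧ Nonempty (U ≃ₜ (Fin 3 → ℝ)) := by
  have key : ∀ x y, Relation.EqvGen r x y →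
      (∀ d, c d = x → ∃ d', c d' = y ∧ f d' = f d) ∧
      (∀ d, c d = y → ∃ d', c d' = x ∧ f d' = f d) := by
    intro x y h
    induction h with
    | rel x y h =>
      refine ⟨?_, ?_⟩
      · rintro d rfl; exact h2 d y h
      · rintro d rfl; exact h2 d x (hsymm _ _ h)
    | refl x => exact ⟨fun d hd => ⟨d, hd, rfl⟩, fun d hd => ⟨d, hd, rfl⟩⟩
    | symm x y _ ih => exact ⟨ih.2, ih.1⟩
    | trans x y z _ _ ih1 ih2 =>
      refine ⟨?_, ?_⟩
      · intro d hd
        obtain ⟨d1, h1, h1'⟩ := ih1.1 d hd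
        obtain ⟨d2, h2, h2'⟩ := ih2.1 d1 h1
        exact ⟨d2, h2, h2'.trans h1'⟩
      · intro d hd
        obtain ⟨d1, h1, h1'⟩ := ih2.2 d hd
        obtain ⟨d2, h2, h2'⟩ := ih1.2 d1 h1
        exact ⟨d2, h2, h2'.trans h1'⟩
  set B := Metric.ball e0 δ with hB
  let mk : O → Quotient (Relation.EqvGen.setoid r) := Quotient.mk _
  have hmk : Continuous mk := continuous_quotient_mk'
  have : Nonempty D := ⟨d0⟩
  choose! sec hsec using hsurj
  let h : B → Quotient (Relation.EqvGen.setoid r) := fun e => mk (c (sec e.1))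
  have hval : ∀ d (hd : f d ∈ B), h ⟨f d, hd⟩ = mk (c d) := by
    intro d hd
    exact Quotient.sound (h1 _ _ (hsec _ hd))
  have hcont : Continuous h := by
    have hq : IsQuotientMap (B.restrictPreimage f) := by
      apply IsClosedMap.isQuotientMap
      · exact hf.isClosedMap.restrictPreimage B
      · exact hf.restrictPreimage
      · rintro ⟨e, he⟩
        exact ⟨⟨sec e, by simpa [hsec e he] using he⟩, Subtype.ext (hsec e he)⟩
    rw [hq.continuous_iff]
    have : h ∘ B.restrictPreimage f = fun d => mk (c d.1) := by
      funext d
      exact hval d.1 d.2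
    rw [this]
    exact hmk.comp (hc.comp continuous_subtype_val)
  have hinj : Function.Injective h := by
    rintro ⟨e, he⟩ ⟨e', he'⟩ hee
    have := Quotient.exact hee
    obtain ⟨d', hd', hf'⟩ := (key _ _ this).1 _ rfl
    have h4 := h3 _ _ hd'
    apply Subtype.ext
    simp only [hsec e he, hsec e' he'] at h4 hf'
    exact (hf'.symm.trans h4)
  have hop : IsOpenMap h := by
    intro V hV
    have hV' : IsOpen (Subtype.val '' V : Set E) := (Metric.isOpen_ball.isOpenMap_subtype_val) V hV
    have : IsOpen (mk ⁻¹' (h '' V)) := by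
      have e : mk ⁻¹' (h '' V) = (c '' (f ⁻¹' B)) \ (c '' (f ⁻¹' (Subtype.val '' V : Set E))ᶜ) := by
        ext x
        constructor
        · rintro ⟨⟨e, he⟩, heV, hx⟩
          obtain ⟨d', hd', hf'⟩ := (key _ _ (Quotient.exact hx)).1 _ rfl
          simp only [hsec e he] at hf'
          refine ⟨⟨d', ?_, hd'⟩, ?_⟩
          · simpa [hf'] using he
          · rintro ⟨d2, hd2, hd2'⟩
            apply hd2
            have := h3 d2 d' (hd2'.trans hd'.symm)
            exact ⟨⟨e, he⟩, heV, by rw [this, hf']⟩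
        · rintro ⟨⟨d, hd, rfl⟩, hn⟩
          by_contra hcon
          apply hn
          refine ⟨d, ?_, rfl⟩
          rintro ⟨e, heV, hed⟩
          apply hcon
          refine ⟨e, heV, ?_⟩
          rw [← hval d hd]
          congr 1
          exact Subtype.ext hed
      rw [e]
      apply hopen.sdiff
      exact (((hV'.preimage hf).isClosed_compl).isCompact.image hc).isClosed
    exact this
  have hemb : IsOpenEmbedding h := .of_continuous_injective_isOpenMap hcont hinj hop
  refine ⟨Set.range h, hemb.isOpen_range, ⟨⟨f d0, hd0⟩, hval d0 hd0⟩, ⟨?_⟩⟩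
  have e1 : B ≃ₜ Set.range h := hemb.isEmbedding.toHomeomorph
  have e2 : E ≃ₜ B := by
    have := (OpenPartialHomeomorph.univBall e0 δ).toHomeomorphSourceTarget
    rw [OpenPartialHomeomorph.univBall_source, OpenPartialHomeomorph.univBall_target e0 hδ] at this
    exact (Homeomorph.Set.univ E).symm.trans this
  have e3 : E ≃L[ℝ] (Fin 3 → ℝ) := ContinuousLinearEquiv.ofFinrankEq (by simp [hE])
  exact (e1.symm.trans e2.symm).trans e3.toHomeomorph

/-- Sign of a boolean. -/
noncomputable def sg (b : Bool) : ℝ := if b then 1 else -1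

theorem sg_mul_self (b : Bool) : sg b * sg b = 1 := by cases b <;> simp [sg]

theorem abs_sg (b : Bool) : |sg b| = 1 := by cases b <;> simp [sg]

theorem sg_not (b : Bool) : sg (!b) = - sg b := by cases b <;> simp [sg]

/-- The point with signed coordinates `w` with respect to the octant of `F`. -/
noncomputable def opt (F : OctFace) (w : Fin 3 → ℝ) : Fin 3 → ℝ := fun i => sg (F i) * w i

theorem opt_eq_sum (F : OctFace) (w : Fin 3 → ℝ) :
    ∑ i, w i • vertexPt (i, F i) = opt F w := by
  ext j
  fin_cases j <;> simp [vertexPt, opt, sg]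

theorem opt_eq_sum_perm (F : OctFace) (τ : Equiv.Perm (Fin 3)) (w : Fin 3 → ℝ) :
    ∑ i, w i • vertexPt (τ i, F (τ i)) = opt F (w ∘ τ.symm) := by
  rw [← opt_eq_sum, ← Equiv.sum_comp τ (fun i => (w ∘ τ.symm) i • vertexPt (i, F i))]
  simp

theorem mem_octa (x : Fin 3 → ℝ) : x ∈ SolidOcta ↔ ∑ i, |x i| ≤ 1 := by
  constructor
  · intro hx
    have hconv : Convex ℝ {x : Fin 3 → ℝ | ∑ i, |x i| ≤ 1} := by
      intro x hx y hy a b ha hb hab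
      simp only [Set.mem_ofPred_eq, Pi.add_apply, Pi.smul_apply, smul_eq_mul] at *
      calc ∑ i, |a * x i + b * y i| ≤ ∑ i, (a * |x i| + b * |y i|) := by
            apply Finset.sum_le_sum
            intro i _
            refine (abs_add_le _ _).trans ?_
            rw [abs_mul, abs_mul, abs_of_nonneg ha, abs_of_nonneg hb]
        _ = a * ∑ i, |x i| + b * ∑ i, |y i| := by
            rw [Finset.sum_add_distrib, Finset.mul_sum, Finset.mul_sum]
        _ ≤ 1 := by nlinarith
    refine (convexHull_min ?_ hconv) hx
    rintro _ ⟨⟨i, b⟩, rfl⟩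
    fin_cases i <;> cases b <;> simp [vertexPt, Fin.sum_univ_three]
  · intro hx
    have hC : Convex ℝ SolidOcta := convex_convexHull _ _
    have h0 : (0 : Fin 3 → ℝ) ∈ SolidOcta := by
      have := hC (vertexPt_mem_solidOcta (0, true)) (vertexPt_mem_solidOcta (0, false))
        (show (0:ℝ) ≤ 1/2 by norm_num) (show (0:ℝ) ≤ 1/2 by norm_num) (by norm_num)
      convert this using 1
      ext i
      fin_cases i <;> simp [vertexPt]
    let F : OctFace := fun i => decide (0 ≤ x i)
    have hF : x = opt F (fun i => |x i|) := by
      ext i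
      by_cases h : 0 ≤ x i
      · simp [opt, F, sg, h, abs_of_nonneg h]
      · simp [opt, F, sg, h, abs_of_neg (not_le.1 h)]
    rw [hF, ← opt_eq_sum]
    have := hC.sum_mem (t := Finset.univ) (w := fun o : Option (Fin 3) =>
        match o with | none => 1 - ∑ i, |x i| | some i => |x i|)
      (z := fun o : Option (Fin 3) =>
        match o with | none => 0 | some i => vertexPt (i, F i)) ?_ ?_ ?_
    · simpa [Fintype.sum_option] using this
    · rintro (_ | i) _
      · simpa using hx
      · exact abs_nonneg _
    · simp [Fintype.sum_option]
    · rintro (_ | i) _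
      · exact h0
      · exact vertexPt_mem_solidOcta _

theorem glueRel_iff (g : Gluing) (x y : SolidOcta) : glueRel g x y ↔
    ∃ (F : OctFace) (w : Fin 3 → ℝ), (∀ i, 0 ≤ w i) ∧ (∑ i, w i) = 1 ∧
    (x : Fin 3 → ℝ) = opt F w ∧ (y : Fin 3 → ℝ) = opt (g.face F) (w ∘ (g.axisMap F).symm) := by
  simp only [glueRel, opt_eq_sum, opt_eq_sum_perm]

theorem Gluing.face_face (g : Gluing) (F : OctFace) : g.face (g.face F) = F := g.2.1 F

theorem Gluing.face_ne (g : Gluing) (F : OctFace) : g.face F ≠ F := g.2.2.1 F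

theorem Gluing.axis_face (g : Gluing) (F : OctFace) : g.axisMap (g.face F) = (g.axisMap F)⁻¹ :=
  g.2.2.2.1 F

theorem Gluing.sign_axis (g : Gluing) (F : OctFace) :
    Equiv.Perm.sign (g.axisMap F) = 1 ↔ faceSign F ≠ faceSign (g.face F) :=
  g.2.2.2.2 F

theorem glueRel_symm (g : Gluing) (x y : SolidOcta) (h : glueRel g x y) : glueRel g y x := by
  rw [glueRel_iff] at *
  obtain ⟨F, w, h0, h1, hx, hy⟩ := h
  refine ⟨g.face F, w ∘ (g.axisMap F).symm, fun i => h0 _, ?_, hy, ?_⟩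
  · rw [← h1]; exact Equiv.sum_comp (g.axisMap F).symm w
  · rw [hx, g.face_face, g.axis_face]
    congr 1
    ext i
    simp [Equiv.Perm.inv_def]

/-- A point of the octahedron is on the boundary as soon as it is glued to something. -/
theorem glueRel_boundary (g : Gluing) (x y : SolidOcta) (h : glueRel g x y) :
    ∑ i, |x.1 i| = 1 := by
  rw [glueRel_iff] at h
  obtain ⟨F, w, h0, h1, hx, hy⟩ := h
  rw [hx, ← h1]
  simp [opt, abs_mul, abs_sg, abs_of_nonneg (h0 _)]

theorem interior_case (g : Gluing) (x : SolidOcta) (hx : ∑ i, |x.1 i| < 1) :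
    ∃ U : Set (XSpace g), IsOpen U ∧ Quotient.mk (glueSetoid g) x ∈ U ∧
      Nonempty (U ≃ₜ (Fin 3 → ℝ)) := by
  have ho : IsOpen {y : Fin 3 → ℝ | ∑ i, |y i| < 1} :=
    isOpen_lt (by fun_prop) continuous_const
  obtain ⟨δ, hδ, hsub⟩ := Metric.nhds_basis_closedBall.mem_iff.1 (ho.mem_nhds hx)
  have hsub' : ∀ y ∈ Metric.closedBall x.1 δ, y ∈ SolidOcta := fun y hy =>
    (mem_octa y).2 (le_of_lt (hsub hy))
  have : CompactSpace (Metric.closedBall x.1 δ) :=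
    isCompact_iff_compactSpace.1 (isCompact_closedBall _ _)
  have := chart_lemma (glueRel g) (E := Fin 3 → ℝ) (by simp)
    (c := fun d : Metric.closedBall x.1 δ => (⟨d.1, hsub' _ d.2⟩ : SolidOcta))
    (f := fun d => d.1) (by fun_prop) (by fun_prop) x.1 δ hδ ?_ ?_ ?_ (glueRel_symm g) ?_ ?_
    ⟨x.1, Metric.mem_closedBall_self hδ.le⟩ (Metric.mem_ball_self hδ)
  · exact this
  · intro e he
    exact ⟨⟨e, Metric.ball_subset_closedBall he⟩, rfl⟩
  · intro d d' h
    rw [Subtype.ext h]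
    exact Relation.EqvGen.refl _
  · intro d y h
    exact absurd (glueRel_boundary g _ _ h) (ne_of_lt (hsub d.2))
  · intro d d' h
    exact congrArg (fun s : SolidOcta => s.1) h
  · convert (Metric.isOpen_ball (x := x.1) (ε := δ)).preimage
      (continuous_subtype_val (p := fun y => y ∈ SolidOcta)) using 1
    ext y
    constructor
    · rintro ⟨d, hd, rfl⟩
      exact hd
    · intro hy
      exact ⟨⟨y.1, Metric.ball_subset_closedBall hy⟩, hy, rfl⟩

/-- Flags: a face together with an ordering of the axes (first endpoint, second endpoint, and
the axis opposite to the edge). -/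
abbrev OFlag : Type := OctFace × Equiv.Perm (Fin 3)

/-- The flag across the gluing. -/
def fs (g : Gluing) (φ : OFlag) : OFlag := (g.face φ.1, g.axisMap φ.1 * φ.2)

/-- The flag in the other face at the same edge. -/
def fr (φ : OFlag) : OFlag := (Function.update φ.1 (φ.2 2) (!φ.1 (φ.2 2)), φ.2)

/-- The flag with endpoints of the edge exchanged. -/
def fw (φ : OFlag) : OFlag := (φ.1, φ.2 * Equiv.swap 0 1)

/-- Sign of a boolean, as a unit of the integers. -/
def bu (b : Bool) : ℤˣ := if b then 1 else -1

/-- The orientation of a flag. -/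
def fo (φ : OFlag) : ℤˣ := Equiv.Perm.sign φ.2 * bu (faceSign φ.1)

/-- Going around an edge. -/
def fT (g : Gluing) (φ : OFlag) : OFlag := fr (fs g φ)

theorem fs_fs (g : Gluing) (φ : OFlag) : fs g (fs g φ) = φ := by
  simp [fs, g.face_face, g.axis_face]

theorem fr_fr (φ : OFlag) : fr (fr φ) = φ := by
  simp [fr]

theorem fw_fw (φ : OFlag) : fw (fw φ) = φ := by
  simp [fw, mul_assoc]

theorem fw_fs (g : Gluing) (φ : OFlag) : fw (fs g φ) = fs g (fw φ) := by
  simp [fw, fs, mul_assoc]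

theorem fw_fr (φ : OFlag) : fw (fr φ) = fr (fw φ) := by
  have : (Equiv.swap (0 : Fin 3) 1) 2 = 2 := by decide
  simp [fw, fr, this]

theorem fo_fr (φ : OFlag) : fo (fr φ) = -fo φ := by
  obtain ⟨F, τ⟩ := φ
  have : ∀ (F : OctFace) (i : Fin 3), faceSign (Function.update F i (!F i)) = !faceSign F := by
    decide
  simp only [fo, fr, this]
  cases faceSign F <;> simp [bu]

theorem fo_fw (φ : OFlag) : fo (fw φ) = -fo φ := by
  obtain ⟨F, τ⟩ := φ
  have h : Equiv.Perm.sign (Equiv.swap (0 : Fin 3) 1) = -1 := by decide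
  simp only [fo, fw, Equiv.Perm.sign_mul, h]
  simp

theorem fo_fs (g : Gluing) (φ : OFlag) : fo (fs g φ) = -fo φ := by
  obtain ⟨F, τ⟩ := φ
  simp only [fo, fs, Equiv.Perm.sign_mul]
  have := g.sign_axis F
  rcases Int.units_eq_one_or (Equiv.Perm.sign (g.axisMap F)) with h | h <;>
  rw [h] at this ⊢ <;>
  cases h1 : faceSign F <;> cases h2 : faceSign (g.face F) <;> simp [h1, h2, bu] at this ⊢

theorem fo_fT (g : Gluing) (φ : OFlag) : fo (fT g φ) = fo φ := by
  simp [fT, fo_fr, fo_fs]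

theorem fT_injective (g : Gluing) : Function.Injective (fT g) := by
  intro φ ψ h
  have h1 : fs g φ = fs g ψ := by rw [← fr_fr (fs g φ), ← fr_fr (fs g ψ)]; exact congrArg fr h
  rw [← fs_fs g φ, h1, fs_fs]

theorem fs_fr_fT (g : Gluing) (φ : OFlag) : fs g (fr (fT g φ)) = φ := by
  rw [fT, fr_fr, fs_fs]

/-- An edge never comes back to itself reversed. -/
theorem no_reversal (g : Gluing) : ∀ (k : ℕ) (φ : OFlag), (fT g)^[k] φ ≠ fr (fw φ)
  | 0, φ => by
    intro h
    have := congrArg Prod.snd h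
    simp [fr, fw] at this
  | 1, φ => by
    intro h
    have h1 : fs g φ = fw φ := by
      rw [← fr_fr (fs g φ), ← fr_fr (fw φ)]; exact congrArg fr h
    exact g.face_ne φ.1 (congrArg Prod.fst h1)
  | k + 2, φ => by
    intro h
    apply no_reversal g k (fT g φ)
    apply fT_injective g
    rw [← Function.iterate_succ_apply' (fT g) k, ← Function.iterate_succ_apply, h]
    conv_rhs => rw [fT]
    rw [← fw_fr, ← fw_fr, fT, fr_fr, ← fw_fs, fs_fs, fw_fr]

theorem fo_iterate (g : Gluing) (k : ℕ) (φ : OFlag) : fo ((fT g)^[k] φ) = fo φ := by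
  induction k with
  | zero => rfl
  | succ k ih => rw [Function.iterate_succ_apply', fo_fT, ih]

/-- The point with signed coordinates `w` in the frame given by the flag. -/
noncomputable def ch (φ : OFlag) (w : Fin 3 → ℝ) : Fin 3 → ℝ := opt φ.1 (w ∘ φ.2.symm)

theorem ch_apply (φ : OFlag) (w : Fin 3 → ℝ) (k : Fin 3) :
    ch φ w (φ.2 k) = sg (φ.1 (φ.2 k)) * w k := by simp [ch, opt]

theorem ext_perm {α : Type*} {x y : Fin 3 → α} (τ : Equiv.Perm (Fin 3)) (h0 : x (τ 0) = y (τ 0))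
    (h1 : x (τ 1) = y (τ 1)) (h2 : x (τ 2) = y (τ 2)) : x = y := by
  have : ∀ k, x (τ k) = y (τ k) := by
    intro k
    fin_cases k <;> assumption
  ext i
  obtain ⟨k, rfl⟩ := τ.surjective i
  exact this k

theorem ch_abs_sum (φ : OFlag) (w : Fin 3 → ℝ) : ∑ i, |ch φ w i| = ∑ i, |w i| := by
  rw [← Equiv.sum_comp φ.2]
  simp [ch_apply, abs_mul, abs_sg]

theorem ch_mem (φ : OFlag) (w : Fin 3 → ℝ) (h : ∑ i, |w i| ≤ 1) : ch φ w ∈ SolidOcta := by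
  rw [mem_octa, ch_abs_sum]; exact h

theorem continuous_ch (φ : OFlag) : Continuous (ch φ) := by
  unfold ch opt
  simp only [Function.comp_apply]
  fun_prop

theorem ch_injective (φ : OFlag) (w w' : Fin 3 → ℝ) (h : ch φ w = ch φ w') : w = w' := by
  ext k
  have := congrFun h (φ.2 k)
  rw [ch_apply, ch_apply] at this
  have h2 : sg (φ.1 (φ.2 k)) ≠ 0 := by
    intro h; have := abs_sg (φ.1 (φ.2 k)); rw [h] at this; simp at this
  exact mul_left_cancel₀ h2 this

theorem ch_fr (φ : OFlag) (w : Fin 3 → ℝ) : ch (fr φ) w = ch φ ![w 0, w 1, - w 2] := by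
  apply ext_perm φ.2
  · have := ch_apply (fr φ) w 0
    simp only [fr] at this
    simp only [fr, ch_apply, this]
    simp
  · have := ch_apply (fr φ) w 1
    simp only [fr] at this
    simp only [fr, ch_apply, this]
    simp
  · have := ch_apply (fr φ) w 2
    simp only [fr] at this
    simp only [fr, ch_apply, this]
    simp [sg_not]

theorem glue_ch (g : Gluing) (φ : OFlag) (w : Fin 3 → ℝ) (h0 : ∀ i, 0 ≤ w i) (h1 : ∑ i, w i = 1)
    (x y : SolidOcta) (hx : x.1 = ch φ w) (hy : y.1 = ch (fs g φ) w) : glueRel g x y := by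
  rw [glueRel_iff]
  refine ⟨φ.1, w ∘ φ.2.symm, fun i => h0 _, ?_, hx, ?_⟩
  · rw [← h1]; exact Equiv.sum_comp φ.2.symm w
  · rw [hy, ch, fs]
    congr 1

theorem sg_pos_eq {b b' : Bool} {u v : ℝ} (hu : 0 < u) (hv : 0 ≤ v) (h : sg b * u = sg b' * v) :
    b = b' ∧ u = v := by
  cases b <;> cases b' <;> simp [sg] at h ⊢ <;> linarith

theorem glue_inv (g : Gluing) (φ : OFlag) (w : Fin 3 → ℝ) (h0 : 0 < w 0) (h1 : 0 < w 1)
    (x y : SolidOcta) (hx : x.1 = ch φ w) (h : glueRel g x y) :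
    (0 ≤ w 2 ∧ ∑ i, w i = 1 ∧ y.1 = ch (fs g φ) w) ∨
    (w 2 ≤ 0 ∧ w 0 + w 1 - w 2 = 1 ∧ y.1 = ch (fs g (fr φ)) ![w 0, w 1, - w 2]) := by
  rw [glueRel_iff] at h
  obtain ⟨F, v, hv0, hv1, hxv, hy⟩ := h
  have hopt : ∀ k, sg (φ.1 (φ.2 k)) * w k = sg (F (φ.2 k)) * v (φ.2 k) := by
    intro k
    rw [← ch_apply, ← hx, hxv]; rfl
  obtain ⟨a0, b0⟩ := sg_pos_eq h0 (hv0 _) (hopt 0)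
  obtain ⟨a1, b1⟩ := sg_pos_eq h1 (hv0 _) (hopt 1)
  rw [← Equiv.sum_comp φ.2, Fin.sum_univ_three] at hv1
  by_cases hF : F (φ.2 2) = φ.1 (φ.2 2)
  · left
    have e : F = φ.1 := ext_perm φ.2 a0.symm a1.symm hF
    have h2 := hopt 2
    rw [hF] at h2
    have b2 : w 2 = v (φ.2 2) := by
      have := sg_mul_self (φ.1 (φ.2 2))
      linear_combination (sg (φ.1 (φ.2 2))) * h2 - (w 2 - v (φ.2 2)) * this
    refine ⟨b2 ▸ hv0 _, ?_, ?_⟩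
    · rw [Fin.sum_univ_three, b0, b1, b2, hv1]
    · have hw : v = w ∘ φ.2.symm := by
        apply ext_perm φ.2 <;> simp [*]
      rw [hy, e, hw, ch, fs]
      congr 1
  · right
    have hF' : F (φ.2 2) = !φ.1 (φ.2 2) := by
      cases h : F (φ.2 2) <;> cases h' : φ.1 (φ.2 2) <;> simp_all
    have e : F = (fr φ).1 := by
      apply ext_perm φ.2
      · simp [fr, a0]
      · simp [fr, a1]
      · simp [fr, hF']
    have h2 := hopt 2
    rw [hF', sg_not] at h2
    have b2 : - w 2 = v (φ.2 2) := by
      have := sg_mul_self (φ.1 (φ.2 2))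
      linear_combination -(sg (φ.1 (φ.2 2))) * h2 + (w 2 + v (φ.2 2)) * this
    refine ⟨by have := hv0 (φ.2 2); linarith, by linarith, ?_⟩
    have hw : v = ![w 0, w 1, - w 2] ∘ (fr φ).2.symm := by
      apply ext_perm φ.2 <;> simp [fr, *]
    rw [hy, hw, e, ch, fs]
    congr 1

theorem edge_sep (φ ψ : OFlag) (w v : Fin 3 → ℝ) (hw0 : |w 2| < w 0) (hw1 : |w 2| < w 1)
    (hv0 : |v 2| < v 0) (hv1 : |v 2| < v 1) (h : ch φ w = ch ψ v) :
    ψ = φ ∨ ψ = fr φ ∨ ψ = fw φ ∨ ψ = fr (fw φ) := by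
  obtain ⟨F, τ⟩ := φ
  obtain ⟨G, ρ⟩ := ψ
  have pw0 := (abs_nonneg _).trans_lt hw0
  have pw1 := (abs_nonneg _).trans_lt hw1
  have pv0 := (abs_nonneg _).trans_lt hv0
  have pv1 := (abs_nonneg _).trans_lt hv1
  have hk : ∀ k l, τ k = ρ l → sg (F (τ k)) * w k = sg (G (ρ l)) * v l := by
    intro k l hkl
    have := congrFun h (τ k)
    have e2 := ch_apply (G, ρ) v l
    rw [ch_apply (F, τ) w k] at this
    simp only at this e2
    rw [this, hkl, e2]
  have habs : ∀ k l, τ k = ρ l → |w k| = |v l| := by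
    intro k l hkl
    have := congrArg abs (hk k l hkl)
    simpa [abs_mul, abs_sg] using this
  have big : ∀ k, k ≠ 2 → |w 2| < |w k| := by
    intro k hk
    fin_cases k
    · simpa [abs_of_pos pw0] using hw0
    · simpa [abs_of_pos pw1] using hw1
    · simp at hk
  have big' : ∀ k, k ≠ 2 → |v 2| < |v k| := by
    intro k hk
    fin_cases k
    · simpa [abs_of_pos pv0] using hv0
    · simpa [abs_of_pos pv1] using hv1
    · simp at hk
  have h22 : τ 2 = ρ 2 := by
    by_contra hne
    obtain ⟨k, hk1⟩ := τ.surjective (ρ 2)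
    obtain ⟨l, hl1⟩ := ρ.surjective (τ 2)
    have hk2 : k ≠ 2 := by rintro rfl; exact hne hk1
    have hl2 : l ≠ 2 := by rintro rfl; exact hne hl1.symm
    have a1 := habs k 2 hk1
    have a2 := habs 2 l hl1.symm
    have := big k hk2
    have := big' l hl2
    linarith
  have hperm : ∀ τ ρ : Equiv.Perm (Fin 3), τ 2 = ρ 2 → ρ = τ ∨ ρ = τ * Equiv.swap 0 1 := by
    decide
  have hfin : (F (τ 0) = G (τ 0) ∧ F (τ 1) = G (τ 1)) →
      G = F ∨ G = Function.update F (τ 2) (!F (τ 2)) := by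
    rintro ⟨a0, a1⟩
    by_cases a2 : F (τ 2) = G (τ 2)
    · left; exact (ext_perm τ a0 a1 a2).symm
    · right
      apply ext_perm τ
      · simp [a0]
      · simp [a1]
      · simp
        cases h : F (τ 2) <;> cases h' : G (τ 2) <;> simp_all
  rcases hperm τ ρ h22 with rfl | hρ
  · have := hfin ⟨(sg_pos_eq pw0 pv0.le (hk 0 0 rfl)).1, (sg_pos_eq pw1 pv1.le (hk 1 1 rfl)).1⟩
    rcases this with rfl | rfl
    · left; rfl
    · right; left; rfl
  · have e0 : τ 0 = ρ 1 := by simp [hρ]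
    have e1 : τ 1 = ρ 0 := by simp [hρ]
    have := hfin ⟨by have := (sg_pos_eq pw0 pv1.le (hk 0 1 e0)).1; rwa [← e0] at this,
      by have := (sg_pos_eq pw1 pv0.le (hk 1 0 e1)).1; rwa [← e1] at this⟩
    rcases this with hG | hG
    · right; right; left
      simp [fw, hG, hρ]
    · right; right; right
      rw [← fw_fr]
      simp [fw, fr, hG, hρ]

theorem bool_ne : ∀ a b : Bool, ¬ a = b → b = !a := by decide

/-- Signed coordinates in the frame of a flag. -/
noncomputable def sc (φ : OFlag) (x : Fin 3 → ℝ) : Fin 3 → ℝ :=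
  fun k => sg (φ.1 (φ.2 k)) * x (φ.2 k)

theorem sc_ch (φ : OFlag) (w : Fin 3 → ℝ) : sc φ (ch φ w) = w := by
  ext k
  rw [sc, ch_apply, ← mul_assoc, sg_mul_self, one_mul]

theorem ch_sc (φ : OFlag) (x : Fin 3 → ℝ) : ch φ (sc φ x) = x := by
  have : ∀ k, ch φ (sc φ x) (φ.2 k) = x (φ.2 k) := by
    intro k
    rw [ch_apply, sc, ← mul_assoc, sg_mul_self, one_mul]
  exact ext_perm φ.2 (this 0) (this 1) (this 2)

theorem continuous_sc (φ : OFlag) : Continuous (sc φ) := by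
  unfold sc
  fun_prop

theorem sc_sum (φ : OFlag) (x : SolidOcta) :
    |sc φ x.1 0| + |sc φ x.1 1| + |sc φ x.1 2| ≤ 1 := by
  have h := (mem_octa x.1).1 x.2
  rw [← ch_sc φ x.1, ch_abs_sum, Fin.sum_univ_three] at h
  exact h

/-- Frame coordinates near a face. -/
def fcw (d : ℝ × ℝ × ℝ) : Fin 3 → ℝ := ![d.1, d.2.1, 1 - d.1 - d.2.1 - d.2.2]

/-- Compact neighbourhood in frame coordinates near a face. -/
def fcM (p q δ : ℝ) : Set (ℝ × ℝ × ℝ) :=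
  {d | |d.1 - p| ≤ δ ∧ |d.2.1 - q| ≤ δ ∧ 0 ≤ d.2.2 ∧ d.2.2 ≤ δ}

theorem fcM_compact (p q δ : ℝ) : IsCompact (fcM p q δ) := by
  have hcl : IsClosed (fcM p q δ) := by
    unfold fcM
    refine IsClosed.and ?_ (IsClosed.and ?_ (IsClosed.and ?_ ?_)) <;>
    exact isClosed_le (by fun_prop) (by fun_prop)
  refine (isCompact_Icc (a := (p - δ, q - δ, (0 : ℝ))) (b := (p + δ, q + δ, δ))).of_isClosed_subset
    hcl ?_
  rintro ⟨a, b, c⟩ ⟨h1, h2, h3, h4⟩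
  rw [abs_le] at h1 h2
  simp only [Set.mem_Icc, Prod.mk_le_mk] at *
  refine ⟨⟨?_, ?_, ?_⟩, ?_, ?_, ?_⟩ <;> linarith

theorem continuous_fcw : Continuous fcw := by
  unfold fcw
  fun_prop

theorem face_case (g : Gluing) (x : SolidOcta) (φ₀ : OFlag) (p q : ℝ) (hp : 0 < p) (hq : 0 < q)
    (hpq : p + q < 1) (hx : x.1 = ch φ₀ (fcw (p, q, 0))) :
    ∃ U : Set (XSpace g), IsOpen U ∧ Quotient.mk (glueSetoid g) x ∈ U ∧
      Nonempty (U ≃ₜ (Fin 3 → ℝ)) := by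
  obtain ⟨δ, hδ, h1, h2, h3⟩ : ∃ δ : ℝ, 0 < δ ∧ δ < p ∧ δ < q ∧ p + q + 3 * δ < 1 := by
    refine ⟨min (p / 2) (min (q / 2) ((1 - p - q) / 4)), ?_, ?_, ?_, ?_⟩
    · refine lt_min (by linarith) (lt_min (by linarith) (by linarith))
    · exact (min_le_left _ _).trans_lt (by linarith)
    · exact ((min_le_right _ _).trans (min_le_left _ _)).trans_lt (by linarith)
    · have := ((min_le_right (p / 2) (min (q / 2) ((1 - p - q) / 4))).trans (min_le_right _ _))
      linarith
  have : CompactSpace (fcM p q δ) := isCompact_iff_compactSpace.1 (fcM_compact p q δ)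
  have pos : ∀ d ∈ fcM p q δ, 0 < fcw d 0 ∧ 0 < fcw d 1 ∧ 0 < fcw d 2 := by
    rintro ⟨a, b, m⟩ ⟨k1, k2, k3, k4⟩
    rw [abs_le] at k1 k2
    simp only [fcw] at *
    refine ⟨?_, ?_, ?_⟩
    · simp; linarith
    · simp; linarith
    · simp; linarith
  have sum : ∀ d, fcw d 0 + fcw d 1 + fcw d 2 = 1 - d.2.2 := by
    intro d; simp [fcw]; ring
  have mem : ∀ φ : OFlag, ∀ d ∈ fcM p q δ, ch φ (fcw d) ∈ SolidOcta := by
    intro φ d hd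
    obtain ⟨a0, a1, a2⟩ := pos d hd
    apply ch_mem
    rw [Fin.sum_univ_three, abs_of_pos a0, abs_of_pos a1, abs_of_pos a2, sum]
    linarith [hd.2.2.1]
  let Φ : Bool → OFlag := fun ε => if ε then φ₀ else fs g φ₀
  have hΦ : ∀ ε, fs g (Φ ε) = Φ (!ε) := by
    intro ε; cases ε <;> simp [Φ, fs_fs]
  let c : Bool × fcM p q δ → SolidOcta := fun d => ⟨ch (Φ d.1) (fcw d.2.1), mem _ _ d.2.2⟩
  let f : Bool × fcM p q δ → ℝ × ℝ × ℝ := fun d => (d.2.1.1, d.2.1.2.1, sg d.1 * d.2.1.2.2)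
  have glue0 : ∀ ε (d : fcM p q δ), d.1.2.2 = 0 → glueRel g (c (ε, d)) (c (!ε, d)) := by
    intro ε d hd
    obtain ⟨a0, a1, a2⟩ := pos d.1 d.2
    apply glue_ch g (Φ ε) (fcw d.1)
    · intro i; fin_cases i
      · exact a0.le
      · exact a1.le
      · exact a2.le
    · rw [Fin.sum_univ_three, sum, hd]; simp
    · rfl
    · rw [hΦ]
  have hinj : ∀ d d' : ℝ × ℝ × ℝ, fcw d = fcw d' → d = d' := by
    intro d d' h
    have e0 := congrFun h 0
    have e1 := congrFun h 1
    have e2 := congrFun h 2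
    simp [fcw] at e0 e1 e2
    refine Prod.ext e0 (Prod.ext e1 ?_)
    linarith
  have hball : ∀ d : Bool × fcM p q δ, f d ∈ Metric.ball ((p, q, 0) : ℝ × ℝ × ℝ) δ ↔
      |d.2.1.1 - p| < δ ∧ |d.2.1.2.1 - q| < δ ∧ d.2.1.2.2 < δ := by
    intro d
    simp [f, Prod.dist_eq, Real.dist_eq, abs_sg, abs_of_nonneg d.2.2.2.2.1]
  have h00 : ((p, q, 0) : ℝ × ℝ × ℝ) ∈ fcM p q δ := by
    simp [fcM, hδ.le]
  have hcx : x = c (true, ⟨(p, q, 0), h00⟩) := Subtype.ext (by rw [hx]; simp [c, Φ])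
  rw [hcx]
  refine chart_lemma (glueRel g) (E := ℝ × ℝ × ℝ) (by simp) c f ?_ ?_ (p, q, 0) δ hδ
    ?_ ?_ ?_ (glueRel_symm g) ?_ ?_ _ ?_
  · rw [continuous_prod_of_discrete_left]
    intro ε
    have h := (continuous_ch (Φ ε)).comp
      (continuous_fcw.comp (continuous_subtype_val (p := fun d => d ∈ fcM p q δ)))
    exact Continuous.subtype_mk h fun d => mem _ _ d.2
  · rw [continuous_prod_of_discrete_left]
    intro ε
    simp only [f]
    fun_prop
  · rintro ⟨a, b, m⟩ he
    simp [Prod.dist_eq, Real.dist_eq] at he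
    obtain ⟨k1, k2, k3⟩ := he
    refine ⟨(decide (0 ≤ m), ⟨(a, b, |m|), k1.le, k2.le, abs_nonneg _, k3.le⟩), ?_⟩
    by_cases hm : 0 ≤ m
    · simp [f, sg, hm, abs_of_nonneg hm]
    · simp [f, sg, hm, abs_of_neg (not_le.1 hm)]
  · rintro ⟨ε, d, hd⟩ ⟨ε', d', hd'⟩ h
    simp only [f, Prod.mk.injEq] at h
    obtain ⟨e1, e2, e3⟩ := h
    have e4 : d.2.2 = d'.2.2 := by
      have := congrArg abs e3
      simpa [abs_mul, abs_sg, abs_of_nonneg hd.2.2.1, abs_of_nonneg hd'.2.2.1] using this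
    have e5 : d = d' := Prod.ext e1 (Prod.ext e2 e4)
    subst e5
    by_cases hε : ε = ε'
    · subst hε; exact Relation.EqvGen.refl _
    · have : ε' = !ε := bool_ne _ _ hε
      subst this
      apply Relation.EqvGen.rel
      apply glue0
      cases ε <;> simp [sg] at e3 <;> simp <;> linarith
  · rintro ⟨ε, d⟩ y h
    obtain ⟨a0, a1, a2⟩ := pos d.1 d.2
    rcases glue_inv g (Φ ε) (fcw d.1) a0 a1 (c (ε, d)) y rfl h with ⟨_, hs, hy⟩ | ⟨hn, _⟩
    · rw [Fin.sum_univ_three, sum] at hs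
      refine ⟨(!ε, d), Subtype.ext ?_, ?_⟩
      · rw [hy, hΦ]
      · have : d.1.2.2 = 0 := by linarith
        simp [f, this]
    · linarith
  · rintro ⟨ε, d⟩ ⟨ε', d'⟩ h
    have h := congrArg (fun s : SolidOcta => s.1) h
    simp only [c] at h
    by_cases hε : ε = ε'
    · subst hε
      have := hinj _ _ (ch_injective _ _ _ h)
      rw [Subtype.ext this]
    · exfalso
      have hF : (Φ ε').1 ≠ (Φ ε).1 := by
        have : ε' = !ε := bool_ne _ _ hε
        rw [this, ← hΦ]
        exact g.face_ne _
      apply hF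
      have hpos : ∀ d ∈ fcM p q δ, ∀ i, 0 < fcw d i := by
        intro d hd i
        obtain ⟨a0, a1, a2⟩ := pos d hd
        fin_cases i <;> assumption
      ext i : 1
      have h := congrFun h i
      simp only [ch, opt, Function.comp_apply] at h
      exact (sg_pos_eq (hpos _ d.2 _) (hpos _ d'.2 _).le h).1.symm
  · have : c '' (f ⁻¹' Metric.ball ((p, q, 0) : ℝ × ℝ × ℝ) δ) =
        ⋃ ε : Bool, {y : SolidOcta | |sc (Φ ε) y.1 0 - p| < δ ∧ |sc (Φ ε) y.1 1 - q| < δ ∧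
          1 - sc (Φ ε) y.1 0 - sc (Φ ε) y.1 1 - sc (Φ ε) y.1 2 < δ} := by
      ext y
      simp only [Set.mem_iUnion, Set.mem_ofPred_eq]
      constructor
      · rintro ⟨⟨ε, d⟩, hd, rfl⟩
        rw [Set.mem_preimage, hball] at hd
        refine ⟨ε, ?_⟩
        simp only [c, sc_ch]
        simpa [fcw] using hd
      · rintro ⟨ε, k1, k2, k3⟩
        have hs := sc_sum (Φ ε) y
        have l0 := le_abs_self (sc (Φ ε) y.1 0)
        have l1 := le_abs_self (sc (Φ ε) y.1 1)
        have l2 := le_abs_self (sc (Φ ε) y.1 2)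
        have hd : (sc (Φ ε) y.1 0, sc (Φ ε) y.1 1,
            1 - sc (Φ ε) y.1 0 - sc (Φ ε) y.1 1 - sc (Φ ε) y.1 2) ∈ fcM p q δ :=
          ⟨k1.le, k2.le, by simp only; linarith, k3.le⟩
        refine ⟨(ε, ⟨_, hd⟩), ?_, ?_⟩
        · rw [Set.mem_preimage, hball]
          exact ⟨k1, k2, k3⟩
        · apply Subtype.ext
          simp only [c]
          conv_rhs => rw [← ch_sc (Φ ε) y.1]
          congr 1
          ext k
          fin_cases k <;> simp [fcw]
    rw [this]
    apply isOpen_iUnion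
    intro ε
    have hcs : ∀ k, Continuous fun y : SolidOcta => sc (Φ ε) y.1 k := fun k =>
      (continuous_apply k).comp ((continuous_sc _).comp continuous_subtype_val)
    have c0 := hcs 0
    have c1 := hcs 1
    have c2 := hcs 2
    refine IsOpen.and ?_ (IsOpen.and ?_ ?_) <;> exact isOpen_lt (by fun_prop) (by fun_prop)
  · rw [hball]
    simp [hδ]

/-- The unit complex number at angle `s / n` turns. -/
noncomputable def ang (n : ℕ) (s : ℝ) : ℂ := Complex.exp (((2 * Real.pi * (s / n) : ℝ) : ℂ) * Complex.I)

theorem norm_ang (n : ℕ) (s : ℝ) : ‖ang n s‖ = 1 := Complex.norm_exp_ofReal_mul_I _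

theorem ang_eq_iff (n : ℕ) (hn : 0 < n) (s s' : ℝ) :
    ang n s = ang n s' ↔ ∃ z : ℤ, s = s' + n * z := by
  have hn' : (n : ℝ) ≠ 0 := by positivity
  have hp := Real.pi_ne_zero
  unfold ang
  rw [Complex.exp_eq_exp_iff_exists_int]
  refine exists_congr fun z => ?_
  constructor
  · intro h
    have h2 := congrArg Complex.im h
    simp only [Complex.mul_im, Complex.add_im, Complex.ofReal_re, Complex.ofReal_im, Complex.I_re,
      Complex.I_im, Complex.intCast_re, Complex.intCast_im, Complex.mul_re] at h2
    norm_num at h2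
    field_simp at h2
    linarith
  · intro h
    rw [h]
    have : (n : ℂ) ≠ 0 := by exact_mod_cast hn.ne'
    push_cast
    field_simp

/-- Developing a quadrant `(a, b)` as the `k`-th sector out of `n`. -/
noncomputable def pl (n k : ℕ) (a b : ℝ) : ℂ := ((a + b : ℝ) : ℂ) * ang n (k + b / (a + b))

theorem norm_pl (n k : ℕ) (a b : ℝ) : ‖pl n k a b‖ = |a + b| := by
  simp only [pl, norm_mul, norm_ang, mul_one, Complex.norm_real, Real.norm_eq_abs]

theorem continuous_pl (n k : ℕ) : Continuous fun x : ℝ × ℝ => pl n k x.1 x.2 := by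
  rw [continuous_iff_continuousAt]
  intro x
  by_cases hx : x.1 + x.2 = 0
  · have h0 : pl n k x.1 x.2 = 0 := by simp [pl, hx]
    change Filter.Tendsto _ _ (nhds (pl n k x.1 x.2))
    rw [h0]
    refine squeeze_zero_norm (a := fun y : ℝ × ℝ => |y.1 + y.2|) (fun y => (norm_pl _ _ _ _).le) ?_
    have : Continuous fun y : ℝ × ℝ => |y.1 + y.2| := by fun_prop
    have := this.tendsto x
    simpa [hx] using this
  · unfold pl ang
    have : ContinuousAt (fun y : ℝ × ℝ => y.2 / (y.1 + y.2)) x :=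
      ContinuousAt.div (by fun_prop) (by fun_prop) hx
    fun_prop

theorem pl_step (n k : ℕ) (hn : 0 < n) (b : ℝ) : pl n k 0 b = pl n ((k + 1) % n) b 0 := by
  by_cases hb : b = 0
  · simp [pl, hb]
  · unfold pl
    simp only [zero_add, add_zero, zero_div, div_self hb]
    congr 1
    rw [ang_eq_iff n hn]
    refine ⟨(((k + 1) / n : ℕ) : ℤ), ?_⟩
    have : (((k + 1) % n + n * ((k + 1) / n) : ℕ) : ℝ) = ((k + 1 : ℕ) : ℝ) := by
      rw [Nat.mod_add_div]
    push_cast at this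
    rw [Int.cast_natCast]
    linarith

theorem pl_surj (n : ℕ) (hn : 0 < n) (z : ℂ) :
    ∃ k < n, ∃ a b : ℝ, 0 ≤ a ∧ 0 ≤ b ∧ pl n k a b = z := by
  by_cases hz : z = 0
  · exact ⟨0, hn, 0, 0, le_rfl, le_rfl, by simp [pl, hz]⟩
  have hn' : (0 : ℝ) < n := by exact_mod_cast hn
  set s : ℝ := n * Int.fract (z.arg / (2 * Real.pi)) with hs
  have hs0 : 0 ≤ s := mul_nonneg hn'.le (Int.fract_nonneg _)
  have hs1 : s < n := by
    have := Int.fract_lt_one (z.arg / (2 * Real.pi))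
    nlinarith
  have hk := Nat.floor_le hs0
  have hk1 := Nat.lt_floor_add_one s
  have hz' : 0 < ‖z‖ := norm_pos_iff.2 hz
  refine ⟨⌊s⌋₊, (Nat.floor_lt hs0).2 hs1, ‖z‖ * (1 - (s - ⌊s⌋₊)), ‖z‖ * (s - ⌊s⌋₊), ?_, ?_, ?_⟩
  · apply mul_nonneg hz'.le; linarith
  · apply mul_nonneg hz'.le; linarith
  · unfold pl
    have e1 : ‖z‖ * (1 - (s - ⌊s⌋₊)) + ‖z‖ * (s - ⌊s⌋₊) = ‖z‖ := by ring
    have e2 : (⌊s⌋₊ : ℝ) + ‖z‖ * (s - ⌊s⌋₊) / ‖z‖ = s := by field_simp; ring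
    rw [e1, e2]
    have e3 : ang n s = ang n (n * (z.arg / (2 * Real.pi))) := by
      rw [ang_eq_iff n hn]
      refine ⟨-⌊z.arg / (2 * Real.pi)⌋, ?_⟩
      rw [hs, Int.fract]
      push_cast
      ring
    rw [e3]
    have e4 : 2 * Real.pi * (n * (z.arg / (2 * Real.pi)) / n) = z.arg := by
      have := Real.pi_ne_zero
      field_simp
    rw [ang, e4]
    exact Complex.norm_mul_exp_arg_mul_I z

theorem pl_eq (n : ℕ) (hn : 0 < n) (k k' : ℕ) (hk : k < n) (hk' : k' < n) (a b a' b' : ℝ)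
    (ha : 0 ≤ a) (hb : 0 ≤ b) (ha' : 0 ≤ a') (hb' : 0 ≤ b') (h : pl n k a b = pl n k' a' b') :
    (k = k' ∧ a = a' ∧ b = b') ∨ (a = 0 ∧ b = 0 ∧ a' = 0 ∧ b' = 0) ∨
    (k' = (k + 1) % n ∧ a = 0 ∧ b' = 0 ∧ a' = b) ∨ (k = (k' + 1) % n ∧ a' = 0 ∧ b = 0 ∧ a = b') := by
  have hr : a + b = a' + b' := by
    have := congrArg norm h
    rwa [norm_pl, norm_pl, abs_of_nonneg (by positivity), abs_of_nonneg (by positivity)] at this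
  by_cases h0 : a + b = 0
  · right; left
    refine ⟨?_, ?_, ?_, ?_⟩ <;> linarith
  have hpos : 0 < a + b := lt_of_le_of_ne (by positivity) (Ne.symm h0)
  unfold pl at h
  rw [← hr] at h
  have h := mul_left_cancel₀ (by exact_mod_cast h0) h
  rw [ang_eq_iff n hn] at h
  obtain ⟨z, hz⟩ := h
  set θ := b / (a + b) with hθ
  set θ' := b' / (a + b) with hθ'
  have t0 : 0 ≤ θ := by positivity
  have t0' : 0 ≤ θ' := by positivity
  have t1 : θ ≤ 1 := by rw [hθ, div_le_one hpos]; linarith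
  have t1' : θ' ≤ 1 := by rw [hθ', div_le_one hpos]; linarith
  have eb : b = θ * (a + b) := by rw [hθ]; field_simp
  have eb' : b' = θ' * (a + b) := by rw [hθ']; field_simp
  have hd : ((k' + n * z - k : ℤ) : ℝ) = θ - θ' := by push_cast; linarith
  have hd1 : (k' + n * z - k : ℤ) ≤ 1 := by
    have : ((k' + n * z - k : ℤ) : ℝ) ≤ 1 := by rw [hd]; linarith
    exact_mod_cast this
  have hd2 : -1 ≤ (k' + n * z - k : ℤ) := by
    have : (-1 : ℝ) ≤ ((k' + n * z - k : ℤ) : ℝ) := by rw [hd]; linarith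
    exact_mod_cast this
  have mod_eq : ∀ p q : ℕ, q < n → (∃ w : ℤ, (q : ℤ) = p + n * w) → q = p % n := by
    rintro p q hq ⟨w, hw⟩
    have h1 : ((q : ℤ)) % n = (p : ℤ) % n := by rw [hw]; simp
    have h2 : q % n = p % n := by exact_mod_cast h1
    rwa [Nat.mod_eq_of_lt hq] at h2
  have h3 : (k' + n * z - k : ℤ) = 0 ∨ (k' + n * z - k : ℤ) = 1 ∨ (k' + n * z - k : ℤ) = -1 := by
    omega
  rcases h3 with h3 | h3 | h3
  · left
    rw [h3] at hd
    have hθθ : θ = θ' := by push_cast at hd; linarith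
    have hbb : b = b' := by rw [eb, eb', hθθ]
    refine ⟨?_, by linarith, hbb⟩
    have := mod_eq k' k hk ⟨z, by linarith⟩
    rwa [Nat.mod_eq_of_lt hk'] at this
  · right; right; left
    rw [h3] at hd
    push_cast at hd
    have e1 : θ = 1 := by linarith
    have e2 : θ' = 0 := by linarith
    rw [e1] at eb
    rw [e2] at eb'
    refine ⟨mod_eq (k + 1) k' hk' ⟨-z, by push_cast; linarith⟩, by linarith, by linarith, by linarith⟩
  · right; right; right
    rw [h3] at hd
    push_cast at hd
    have e1 : θ = 0 := by linarith
    have e2 : θ' = 1 := by linarith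
    rw [e1] at eb
    rw [e2] at eb'
    refine ⟨mod_eq (k' + 1) k hk ⟨z, by push_cast; linarith⟩, by linarith, by linarith, by linarith⟩

/-- Frame coordinates near an edge. -/
noncomputable def ew (d : ℝ × ℝ × ℝ) : Fin 3 → ℝ :=
  ![(1 - (d.2.1 + d.2.2) / 2 + d.1) / 2, (1 - (d.2.1 + d.2.2) / 2 - d.1) / 2, (d.2.2 - d.2.1) / 2]

/-- Compact neighbourhood in frame coordinates near an edge. -/
def eM (t δ : ℝ) : Set (ℝ × ℝ × ℝ) :=
  {d | |d.1 - t| ≤ δ ∧ 0 ≤ d.2.1 ∧ 0 ≤ d.2.2 ∧ d.2.1 + d.2.2 ≤ δ}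

theorem eM_compact (t δ : ℝ) : IsCompact (eM t δ) := by
  have hcl : IsClosed (eM t δ) := by
    unfold eM
    refine IsClosed.and ?_ (IsClosed.and ?_ (IsClosed.and ?_ ?_)) <;>
    exact isClosed_le (by fun_prop) (by fun_prop)
  refine (isCompact_Icc (a := (t - δ, (0 : ℝ), (0 : ℝ))) (b := (t + δ, δ, δ))).of_isClosed_subset
    hcl ?_
  rintro ⟨a, b, c⟩ ⟨h1, h2, h3, h4⟩
  rw [abs_le] at h1
  simp only [Set.mem_Icc, Prod.mk_le_mk] at *
  refine ⟨⟨?_, ?_, ?_⟩, ?_, ?_, ?_⟩ <;> linarith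

theorem continuous_ew : Continuous ew := by
  unfold ew
  fun_prop

theorem ew_inj (d d' : ℝ × ℝ × ℝ) (h : ew d = ew d') : d = d' := by
  have e0 := congrFun h 0
  have e1 := congrFun h 1
  have e2 := congrFun h 2
  simp [ew] at e0 e1 e2
  refine Prod.ext ?_ (Prod.ext ?_ ?_) <;> linarith

theorem ew_flip (t a b : ℝ) : ![ew (t, a, b) 0, ew (t, a, b) 1, - ew (t, a, b) 2] = ew (t, b, a) := by
  ext k
  fin_cases k <;> simp [ew] <;> ring

theorem ch_fr_ew (φ : OFlag) (t a b : ℝ) : ch (fr φ) (ew (t, a, b)) = ch φ (ew (t, b, a)) := by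
  rw [ch_fr, ew_flip]

theorem edge_case (g : Gluing) (x : SolidOcta) (φ₀ : OFlag) (t₀ : ℝ) (ht : |t₀| < 1)
    (hx : x.1 = ch φ₀ (ew (t₀, 0, 0))) :
    ∃ U : Set (XSpace g), IsOpen U ∧ Quotient.mk (glueSetoid g) x ∈ U ∧
      Nonempty (U ≃ₜ (Fin 3 → ℝ)) := by
  obtain ⟨δ, hδ⟩ : ∃ δ : ℝ, δ = (1 - |t₀|) / 4 := ⟨_, rfl⟩
  have hδ0 : 0 < δ := by linarith
  have : CompactSpace (eM t₀ δ) := isCompact_iff_compactSpace.1 (eM_compact t₀ δ)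
  have pos : ∀ d ∈ eM t₀ δ, |ew d 2| < ew d 0 ∧ |ew d 2| < ew d 1 := by
    rintro ⟨t, a, b⟩ ⟨k1, k2, k3, k4⟩
    have k5 := abs_le.1 k1
    have k6 := abs_le.1 (le_refl |t₀|)
    simp only [ew] at *
    constructor
    · simp only [Matrix.cons_val]
      rw [abs_lt]; constructor <;> linarith
    · simp only [Matrix.cons_val]
      rw [abs_lt]; constructor <;> linarith
  have pos' : ∀ d ∈ eM t₀ δ, 0 < ew d 0 ∧ 0 < ew d 1 := fun d hd =>
    ⟨(abs_nonneg _).trans_lt (pos d hd).1, (abs_nonneg _).trans_lt (pos d hd).2⟩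
  have mem : ∀ φ : OFlag, ∀ d ∈ eM t₀ δ, ch φ (ew d) ∈ SolidOcta := by
    intro φ d hd
    obtain ⟨a0, a1⟩ := pos' d hd
    apply ch_mem
    rw [Fin.sum_univ_three, abs_of_pos a0, abs_of_pos a1]
    obtain ⟨k1, k2, k3, k4⟩ := hd
    have : |ew d 2| ≤ (d.2.1 + d.2.2) / 2 := by
      simp only [ew, Matrix.cons_val]
      rw [abs_le]; constructor <;> linarith
    simp only [ew, Matrix.cons_val] at *
    linarith
  obtain ⟨n, hn⟩ : ∃ n : ℕ, n = Function.minimalPeriod (fT g) φ₀ := ⟨_, rfl⟩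
  have hn0 : 0 < n := by
    rw [hn]
    exact Function.minimalPeriod_pos_of_mem_periodicPts ((fT_injective g).mem_periodicPts φ₀)
  let Φ : ℕ → OFlag := fun k => (fT g)^[k] φ₀
  have hmod : ∀ k, Φ (k % n) = Φ k := by
    intro k
    simp only [Φ, hn]
    exact Function.iterate_mod_minimalPeriod_eq
  have hsucc : ∀ k, Φ (k + 1) = fT g (Φ k) := fun k => Function.iterate_succ_apply' _ _ _
  have hΦinj : ∀ k l, k < n → l < n → Φ k = Φ l → k = l := by
    intro k l hk hl h
    exact Function.iterate_injOn_Iio_minimalPeriod (f := fT g) (x := φ₀)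
      (hn ▸ hk : k < _) (hn ▸ hl : l < _) h
  have hrev : ∀ k l, k ≤ l → Φ l ≠ fr (fw (Φ k)) := by
    intro k l hkl h
    obtain ⟨m, rfl⟩ := Nat.exists_eq_add_of_le hkl
    apply no_reversal g m (Φ k)
    rw [← h]
    simp only [Φ]
    rw [← Function.iterate_add_apply, Nat.add_comm]
  have hrev' : ∀ k l, Φ l ≠ fr (fw (Φ k)) := by
    intro k l h
    rcases le_total k l with hkl | hkl
    · exact hrev k l hkl h
    · apply hrev l k hkl
      rw [h, fw_fr, fw_fw, fr_fr]
  have hfo : ∀ k, fo (Φ k) = fo φ₀ := fun k => fo_iterate g k φ₀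
  have hfone : ∀ u : ℤˣ, u ≠ -u := by decide
  let c : Fin n × eM t₀ δ → SolidOcta := fun d => ⟨ch (Φ d.1) (ew d.2.1), mem _ _ d.2.2⟩
  let f : Fin n × eM t₀ δ → ℝ × ℂ := fun d => (d.2.1.1, pl n d.1 d.2.1.2.1 d.2.1.2.2)
  have glue0 : ∀ (k l : Fin n) (t b : ℝ) (h : (t, 0, b) ∈ eM t₀ δ) (h' : (t, b, 0) ∈ eM t₀ δ),
      (l : ℕ) = (k + 1) % n → glueRel g (c (k, ⟨_, h⟩)) (c (l, ⟨_, h'⟩)) := by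
    intro k l t b h h' hl
    obtain ⟨a0, a1⟩ := pos' _ h
    have hb := h.2.2.1
    apply glue_ch g (Φ k) (ew (t, 0, b))
    · intro i; fin_cases i
      · exact a0.le
      · exact a1.le
      · simp [ew]; exact div_nonneg hb (by norm_num)
    · rw [Fin.sum_univ_three]; simp [ew]; ring
    · rfl
    · simp only [c]
      rw [hl, hmod, hsucc, fT, ch_fr_ew]
  have swapm : ∀ t a b, (t, a, b) ∈ eM t₀ δ → (t, b, a) ∈ eM t₀ δ := by
    rintro t a b ⟨k1, k2, k3, k4⟩
    exact ⟨k1, k3, k2, by simp only at *; linarith⟩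
  have glue1 : ∀ (k l : Fin n) (t b : ℝ) (h : (t, 0, b) ∈ eM t₀ δ) (h' : (t, b, 0) ∈ eM t₀ δ),
      (l : ℕ) = (k + 1) % n → Relation.EqvGen (glueRel g) (c (k, ⟨_, h⟩)) (c (l, ⟨_, h'⟩)) :=
    fun k l t b h h' hl => Relation.EqvGen.rel _ _ (glue0 k l t b h h' hl)
  have glueAxis0 : ∀ (t : ℝ) (h : (t, 0, 0) ∈ eM t₀ δ) (k : ℕ) (hk : k < n),
      Relation.EqvGen (glueRel g) (c (⟨0, hn0⟩, ⟨_, h⟩)) (c (⟨k, hk⟩, ⟨_, h⟩)) := by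
    intro t h k
    induction k with
    | zero => intro hk; exact Relation.EqvGen.refl _
    | succ k ih =>
      intro hk
      exact (ih (by omega)).trans _ _ _
        (glue1 ⟨k, by omega⟩ ⟨k + 1, hk⟩ t 0 h h (Nat.mod_eq_of_lt hk).symm)
  have hball : ∀ d : Fin n × eM t₀ δ, f d ∈ Metric.ball ((t₀, 0) : ℝ × ℂ) δ ↔
      |d.2.1.1 - t₀| < δ ∧ d.2.1.2.1 + d.2.1.2.2 < δ := by
    intro d
    have : 0 ≤ d.2.1.2.1 + d.2.1.2.2 := add_nonneg d.2.2.2.1 d.2.2.2.2.1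
    simp only [f, Metric.mem_ball, Prod.dist_eq, Real.dist_eq, max_lt_iff, dist_zero_right,
      norm_pl, abs_of_nonneg this]
  have h00 : ((t₀, 0, 0) : ℝ × ℝ × ℝ) ∈ eM t₀ δ := by
    simp [eM, hδ0.le]
  have hcx : x = c (⟨0, hn0⟩, ⟨(t₀, 0, 0), h00⟩) := Subtype.ext (by rw [hx]; simp [c, Φ])
  rw [hcx]
  refine chart_lemma (glueRel g) (E := ℝ × ℂ) (by simp) c f ?_ ?_ (t₀, 0) δ hδ0
    ?_ ?_ ?_ (glueRel_symm g) ?_ ?_ _ ?_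
  · rw [continuous_prod_of_discrete_left]
    intro k
    have h := (continuous_ch (Φ k)).comp
      (continuous_ew.comp (continuous_subtype_val (p := fun d => d ∈ eM t₀ δ)))
    exact Continuous.subtype_mk h fun d => mem _ _ d.2
  · rw [continuous_prod_of_discrete_left]
    intro k
    simp only [f]
    have h := (continuous_pl n k).comp
      (continuous_snd.comp (continuous_subtype_val (p := fun d => d ∈ eM t₀ δ)))
    exact Continuous.prodMk (by fun_prop) h
  · rintro ⟨t, z⟩ he
    simp [Prod.dist_eq, Real.dist_eq] at he
    obtain ⟨k1, k2⟩ := he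
    obtain ⟨k, hk, a, b, ha, hb, hpl⟩ := pl_surj n hn0 z
    have hz := norm_pl n k a b
    rw [hpl, abs_of_nonneg (add_nonneg ha hb)] at hz
    refine ⟨(⟨k, hk⟩, ⟨(t, a, b), k1.le, ha, hb, by simp only; linarith⟩), ?_⟩
    simp only [f, hpl]
  · rintro ⟨k, ⟨t, a, b⟩, hd⟩ ⟨k', ⟨t', a', b'⟩, hd'⟩ h
    simp only [f, Prod.mk.injEq] at h
    obtain ⟨rfl, e2⟩ := h
    rcases pl_eq n hn0 k k' k.2 k'.2 a b a' b' hd.2.1 hd.2.2.1 hd'.2.1 hd'.2.2.1 e2 with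
      ⟨e, rfl, rfl⟩ | ⟨rfl, rfl, rfl, rfl⟩ | ⟨e, rfl, rfl, rfl⟩ | ⟨e, rfl, rfl, rfl⟩
    · rw [Fin.ext e]; exact Relation.EqvGen.refl _
    · exact (glueAxis0 t hd k k.2).symm.trans _ _ _ (glueAxis0 t hd k' k'.2)
    · exact glue1 k k' t _ hd hd' e
    · exact (glue1 k' k t _ hd' hd e).symm
  · rintro ⟨k, ⟨t, a, b⟩, hd⟩ y h
    obtain ⟨a0, a1⟩ := pos' _ hd
    rcases glue_inv g (Φ k) (ew (t, a, b)) a0 a1 _ y rfl h with ⟨_, hs, hy⟩ | ⟨_, hs, hy⟩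
    · have ha : a = 0 := by
        rw [Fin.sum_univ_three] at hs
        simp [ew] at hs
        linarith
      subst ha
      refine ⟨(⟨(k + 1) % n, Nat.mod_lt _ hn0⟩, ⟨(t, b, 0), swapm _ _ _ hd⟩), Subtype.ext ?_, ?_⟩
      · simp only [c]
        rw [hy, hmod, hsucc, fT, ch_fr_ew]
      · simp only [f, Prod.mk.injEq, true_and]
        exact (pl_step n k hn0 b).symm
    · have hb : b = 0 := by
        simp [ew] at hs
        linarith
      subst hb
      obtain ⟨l, hl, hlk⟩ : ∃ l < n, (k : ℕ) = (l + 1) % n := by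
        refine ⟨(k + n - 1) % n, Nat.mod_lt _ hn0, ?_⟩
        have hk := k.2
        rw [Nat.mod_add_mod, show (k : ℕ) + n - 1 + 1 = k + n by omega, Nat.add_mod_right,
          Nat.mod_eq_of_lt hk]
      refine ⟨(⟨l, hl⟩, ⟨(t, 0, a), swapm _ _ _ hd⟩), Subtype.ext ?_, ?_⟩
      · simp only [c]
        rw [hy, ew_flip, hlk, hmod, hsucc, fs_fr_fT]
      · simp only [f, Prod.mk.injEq, true_and]
        rw [hlk]
        exact pl_step n l hn0 a
  · rintro ⟨k, d⟩ ⟨k', d'⟩ h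
    have h := congrArg (fun s : SolidOcta => s.1) h
    simp only [c] at h
    obtain ⟨p1, p2⟩ := pos d.1 d.2
    obtain ⟨p3, p4⟩ := pos d'.1 d'.2
    rcases edge_sep _ _ _ _ p1 p2 p3 p4 h with e | e | e | e
    · have := hΦinj _ _ k'.2 k.2 e
      have hk : k' = k := Fin.ext this
      subst hk
      have := ew_inj _ _ (ch_injective _ _ _ h)
      rw [Subtype.ext this]
    · have := congrArg fo e
      rw [fo_fr, hfo, hfo] at this
      exact absurd this (hfone _)
    · have := congrArg fo e
      rw [fo_fw, hfo, hfo] at this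
      exact absurd this (hfone _)
    · exact absurd e (hrev' _ _)
  · have : c '' (f ⁻¹' Metric.ball ((t₀, 0) : ℝ × ℂ) δ) =
        ⋃ k : Fin n, {y : SolidOcta | |sc (Φ k) y.1 0 - sc (Φ k) y.1 1 - t₀| < δ ∧
          2 * (1 - sc (Φ k) y.1 0 - sc (Φ k) y.1 1) < δ} := by
      ext y
      simp only [Set.mem_iUnion, Set.mem_ofPred_eq]
      constructor
      · rintro ⟨⟨k, d⟩, hd, rfl⟩
        rw [Set.mem_preimage, hball] at hd
        refine ⟨k, ?_⟩
        simp only [c, sc_ch, ew, Matrix.cons_val]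
        simp only at hd
        refine ⟨?_, ?_⟩
        · convert hd.1 using 2; ring
        · linarith [hd.2]
      · rintro ⟨k, k1, k2⟩
        have hs := sc_sum (Φ k) y
        have l0 := le_abs_self (sc (Φ k) y.1 0)
        have l1 := le_abs_self (sc (Φ k) y.1 1)
        have l2 := le_abs_self (sc (Φ k) y.1 2)
        have l3 := neg_abs_le (sc (Φ k) y.1 2)
        have hd : (sc (Φ k) y.1 0 - sc (Φ k) y.1 1,
            1 - sc (Φ k) y.1 0 - sc (Φ k) y.1 1 - sc (Φ k) y.1 2,
            1 - sc (Φ k) y.1 0 - sc (Φ k) y.1 1 + sc (Φ k) y.1 2) ∈ eM t₀ δ :=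
          ⟨k1.le, by simp only; linarith, by simp only; linarith, by simp only; linarith⟩
        refine ⟨(k, ⟨_, hd⟩), ?_, ?_⟩
        · rw [Set.mem_preimage, hball]
          refine ⟨k1, ?_⟩
          simp only
          linarith
        · apply Subtype.ext
          simp only [c]
          conv_rhs => rw [← ch_sc (Φ k) y.1]
          congr 1
          ext i
          fin_cases i <;> simp [ew] <;> ring
    rw [this]
    apply isOpen_iUnion
    intro k
    have hcs : ∀ i, Continuous fun y : SolidOcta => sc (Φ k) y.1 i := fun i =>
      (continuous_apply i).comp ((continuous_sc _).comp continuous_subtype_val)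
    have c0 := hcs 0
    have c1 := hcs 1
    refine IsOpen.and ?_ ?_ <;> exact isOpen_lt (by fun_prop) (by fun_prop)
  · rw [hball]
    simp [hδ0]

theorem eq_ch_abs (x : Fin 3 → ℝ) (τ : Equiv.Perm (Fin 3)) :
    x = ch (fun i => decide (0 ≤ x i), τ) (fun k => |x (τ k)|) := by
  ext i
  by_cases h : 0 ≤ x i
  · simp [ch, opt, sg, h, abs_of_nonneg h]
  · simp [ch, opt, sg, h, abs_of_neg (not_le.1 h)]

theorem vertex_of_zeros (x : Fin 3 → ℝ) (i j k : Fin 3) (hij : i ≠ j) (hik : i ≠ k) (hjk : j ≠ k)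
    (hj : x j = 0) (hk : x k = 0) (hs : |x i| = 1) :
    x = vertexPt (i, decide (0 ≤ x i)) := by
  have hall : ∀ i j k l : Fin 3, i ≠ j → i ≠ k → j ≠ k → l = i ∨ l = j ∨ l = k := by decide
  ext l
  rcases hall i j k l hij hik hjk with rfl | rfl | rfl
  · by_cases h : 0 ≤ x l
    · rw [abs_of_nonneg h] at hs
      simp [vertexPt, hs]
    · have h2 := not_le.1 h
      rw [abs_of_neg h2] at hs
      simp [vertexPt, h]
      linarith
  · simp [vertexPt, hij.symm, hj]
  · simp [vertexPt, hik.symm, hk]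

/-- for every orientation-reversing gluing pattern `g` of the faces of the
octahedron, every point of the quotient space `X(g)` which is not the image of a vertex
of the octahedron has an open neighbourhood homeomorphic to `ℝ³`. -/
theorem nonvertex_points_are_manifold_points (g : Gluing) (p : XSpace g)
    (hp : ∀ v : OctVertex,
      p ≠ Quotient.mk (glueSetoid g) ⟨vertexPt v, vertexPt_mem_solidOcta v⟩) :
    ∃ U : Set (XSpace g), IsOpen U ∧ p ∈ U ∧ Nonempty (U ≃ₜ (Fin 3 → ℝ)) := by
  induction p using Quotient.inductionOn with
  | h x =>
  have hmem := (mem_octa x.1).1 x.2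
  rcases lt_or_eq_of_le hmem with hlt | hone
  · exact interior_case g x hlt
  have hnv : ∀ v : OctVertex, x.1 ≠ vertexPt v := by
    intro v h
    apply hp v
    congr 1
    exact Subtype.ext h
  by_cases hz : ∃ i, x.1 i = 0
  · obtain ⟨i, hi⟩ := hz
    obtain ⟨τ, hτ⟩ : ∃ τ : Equiv.Perm (Fin 3), τ 2 = i := ⟨Equiv.swap 2 i, by simp⟩
    rw [← hτ] at hi
    have hx := eq_ch_abs x.1 τ
    rw [← Equiv.sum_comp τ, Fin.sum_univ_three, hi] at hone
    simp only [abs_zero, add_zero] at hone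
    have n01 : τ 0 ≠ τ 1 := by simp
    have n02 : τ 0 ≠ τ 2 := by simp
    have n12 : τ 1 ≠ τ 2 := by simp
    have h0 : x.1 (τ 0) ≠ 0 := by
      intro h
      rw [h] at hone
      exact hnv _ (vertex_of_zeros x.1 _ _ _ n01.symm n12 n02 h hi (by simpa using hone))
    have h1 : x.1 (τ 1) ≠ 0 := by
      intro h
      rw [h] at hone
      exact hnv _ (vertex_of_zeros x.1 _ _ _ n02 n01 n12.symm hi h (by simpa using hone))
    have p0 := abs_pos.2 h0
    have p1 := abs_pos.2 h1
    refine edge_case g x (fun i => decide (0 ≤ x.1 i), τ) (|x.1 (τ 0)| - |x.1 (τ 1)|) ?_ ?_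
    · rw [abs_lt]; constructor <;> linarith
    · refine hx.trans (congrArg _ ?_)
      ext k
      fin_cases k
      · simp [ew]; linarith
      · simp [ew]; linarith
      · simp [ew, hi]
  · push Not at hz
    have hx := eq_ch_abs x.1 1
    rw [Fin.sum_univ_three] at hone
    have p0 := abs_pos.2 (hz 0)
    have p1 := abs_pos.2 (hz 1)
    have p2 := abs_pos.2 (hz 2)
    refine face_case g x (fun i => decide (0 ≤ x.1 i), 1) |x.1 0| |x.1 1| p0 p1 (by linarith) ?_
    refine hx.trans (congrArg _ ?_)
    ext k
    fin_cases k
    · simp [fcw]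
    · simp [fcw]
    · simp [fcw]; linarith
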